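/- arXiv:1604.02926 — 6 statements merged into one kernel-verified Lean document; each statement's English description precedes it below -/
import Mathlib

section
/- Define ψ, φ as follows: for g₁,…,gₙ ∈ G and t ∈ T put s₀ = t and recursively h_k ∈ Q, s_k ∈ T by s_{k−1}·g_k = h_k·s_k; ψ : Cⁿ(Q,M) → Cⁿ(G, Coind_Q^G(M)) sends μ to the cochain whose value at (g₁,…,gₙ) is the Q-equivariant function taking the value μ(h₁,…,hₙ) at each t ∈ T; φ : Cⁿ(G, Coind_Q^G(M)) → Cⁿ(Q,M) sends θ to (h₁,…,hₙ) ↦ θ(h₁,…,hₙ)(1). For n ≥ 1 define ϖ : Cⁿ(G, Coind_Q^G(M)) → C^{n−1}(G, Coind_Q^G(M)) by ϖ(θ)(g₁,…,g_{n−1})(t) = Σ_{j=0}^{n−1} (−1)^{j+1} θ(h₁,…,h_j, s_j, g_{j+1},…,g_{n−1})(1), where h₁,…,h_{n−1} and s₀,…,s_{n−1} are determined by t and g₁,…,g_{n−1} as above. Then for every n ≥ 0 and every θ ∈ Cⁿ(G, Coind_Q^G(M)) one has ψ(φ(θ)) − θ = ϖ(dⁿθ) + d^{n−1}(ϖ(θ))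 (for n = 0 the second summand is absent); in particular ψ ∘ φ is chain homotopic to the identity, so C*(Q,M) and C*(G, Coind_Q^G(M)) are homotopy equivalent cochain complexes. -/
/-!
Shapiro lemma setup: `G` a group, `Q ≤ G`, `M` a `ℤQ`-module.  The coinduced module is the
set of `Q`-equivariant functions `G → M` with `G`-action `(g • f) x = f (x * g)`; we work with
all of `G → M` and record `Q`-equivariance as the predicate `IsCoind`.
-/

variable {G : Type*} [Group G] (Q : Subgroup G)
variable {M : Type*} [AddCommGroup M] [DistribMulAction Q M]

/-- Membership in the coinduced module `Coind_Q^G(M)`: `Q`-equivariance. -/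
def IsCoind (f : G → M) : Prop :=
  ∀ (q : Q) (x : G), f ((q : G) * x) = q • f x

/-- The left `G`-action on `G → M` underlying the coinduced module, `(g • f) x = f (x * g)`,
as an additive monoid homomorphism. -/
def coindRho (g : G) : (G → M) →+ (G → M) where
  toFun f := fun x => f (x * g)
  map_zero' := rfl
  map_add' _ _ := rfl

/-- The action of `q : Q` on `M` as an additive monoid homomorphism. -/
def qRho (q : Q) : M →+ M :=
  DistribMulAction.toAddMonoidHom M q

/-- The inhomogeneous cochain differential
`(dⁿθ)(g₁,…,g_{n+1}) = g₁·θ(g₂,…,g_{n+1}) + Σᵢ (−1)ⁱ θ(g₁,…,gᵢ·g_{i+1},…,g_{n+1})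
 + (−1)^{n+1} θ(g₁,…,gₙ)`. -/
def dI {P : Type*} [Group P] {N : Type*} [AddCommGroup N]
    (ρ : P → N →+ N) {n : ℕ} (θ : (Fin n → P) → N) : (Fin (n + 1) → P) → N :=
  fun g => ρ (g 0) (θ fun i => g i.succ) +
    ∑ j : Fin (n + 1), ((-1 : ℤ) ^ ((j : ℕ) + 1)) • θ (Fin.contractNth j (· * ·) g)

/-- `sList τf t [g₁, …, g_k]` is `s_k`, where `s₀ = t` and `s_j = τf (s_{j-1} * g_j)`. -/
def sList (τf : G → G) : G → List G → G
  | t, [] => t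
  | t, a :: l => sList τf (τf (t * a)) l

/-- `hSeq Q qf τf t g i` is `h_{i+1} = qf (s_i * g_{i+1})`, so that
`s_i * g_{i+1} = h_{i+1} * s_{i+1}`. -/
def hSeq (qf : G → Q) (τf : G → G) (t : G) {n : ℕ} (g : Fin n → G) (i : Fin n) : Q :=
  qf (sList τf t ((List.ofFn g).take (i : ℕ)) * g i)

/-- `φ : Cⁿ(G, Coind_Q^G M) → Cⁿ(Q, M)`, `φ(θ)(h₁,…,hₙ) = θ(h₁,…,hₙ)(1)`. -/
def phiMap {n : ℕ} (θ : (Fin n → G) → (G → M)) : (Fin n → Q) → M :=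
  fun h => θ (fun i => (h i : G)) 1

/-- The tuple `(h₁, …, h_j, s_j, g_{j+1}, …, gₙ)` appearing in the homotopy `ϖ`. -/
def insertSeq (qf : G → Q) (τf : G → G) (t : G) {n : ℕ} (g : Fin n → G)
    (j : Fin (n + 1)) : Fin (n + 1) → G :=
  fun i =>
    if hij : (i : ℕ) < (j : ℕ) then
      (hSeq Q qf τf t g ⟨(i : ℕ), by have hj := j.isLt; omega⟩ : G)
    else if hij' : (i : ℕ) = (j : ℕ) then
      sList τf t ((List.ofFn g).take (j : ℕ))
    else
      g ⟨(i : ℕ) - 1, by have hi := i.isLt; omega⟩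

section Helpers

theorem contract_cons_zero {n : ℕ} (a : G) (g : Fin (n + 1) → G) :
    Fin.contractNth 0 (· * ·) (Fin.cons a g : Fin (n + 2) → G) =
      Fin.cons (a * g 0) (fun i => g i.succ) := by
  funext i
  refine Fin.cases ?_ (fun i => ?_) i
  · simp [Fin.contractNth]
  · simp [Fin.contractNth]

theorem contract_cons_succ {n : ℕ} (a : G) (g : Fin (n + 1) → G) (j : Fin (n + 1)) :
    Fin.contractNth j.succ (· * ·) (Fin.cons a g : Fin (n + 2) → G) =
      Fin.cons a (Fin.contractNth j (· * ·) g) := by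
  funext i
  refine Fin.cases ?_ (fun i => ?_) i
  · simp [Fin.contractNth]
  · simp [Fin.contractNth]

theorem hSeq_cons (qf : G → Q) (τf : G → G) (t a : G) {n : ℕ} (g : Fin n → G) :
    hSeq Q qf τf t (Fin.cons a g : Fin (n + 1) → G) =
      Fin.cons (qf (t * a)) (hSeq Q qf τf (τf (t * a)) g) := by
  funext i
  refine Fin.cases ?_ (fun i => ?_) i
  · simp [hSeq, sList]
  · simp [hSeq, sList, List.ofFn_succ]

theorem insertSeq_zero (qf : G → Q) (τf : G → G) (t : G) {n : ℕ} (g : Fin n → G) :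
    insertSeq Q qf τf t g 0 = Fin.cons t g := by
  funext i
  refine Fin.cases ?_ (fun i => ?_) i
  · simp [insertSeq, sList]
  · simp [insertSeq]

theorem insertSeq_succ (qf : G → Q) (τf : G → G) (t a : G) {n : ℕ} (g : Fin n → G)
    (j : Fin (n + 1)) :
    insertSeq Q qf τf t (Fin.cons a g : Fin (n + 1) → G) j.succ =
      Fin.cons (qf (t * a) : G) (insertSeq Q qf τf (τf (t * a)) g j) := by
  funext i
  refine Fin.cases ?_ (fun i => ?_) i
  · simp [insertSeq, hSeq, sList]
  · rcases lt_trichotomy (i : ℕ) (j : ℕ) with h | h | h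
    · have hi : (i : ℕ) < n := by have := j.isLt; omega
      have h3 := congrFun (hSeq_cons Q qf τf t a g) (Fin.succ ⟨i, hi⟩)
      simp only [Fin.cons_succ] at h3 ⊢
      simp only [insertSeq, Fin.val_succ, Nat.add_lt_add_iff_right, h, dif_pos]
      rw [← h3]
      rfl
    · simp [insertSeq, h, sList, List.ofFn_succ]
    · have h1 : ¬ (i : ℕ) < (j : ℕ) := by omega
      have h2 : ¬ (i : ℕ) = (j : ℕ) := by omega
      simp only [Fin.cons_succ, insertSeq, Fin.val_succ, Nat.add_lt_add_iff_right, h1, h2,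
        Nat.add_right_cancel_iff, dif_neg, not_false_eq_true]
      have h5 : (⟨(i : ℕ) + 1 - 1, by have := i.isLt; omega⟩ : Fin (n + 1)) =
          Fin.succ ⟨(i : ℕ) - 1, by have := i.isLt; omega⟩ := by
        ext; simp; omega
      rw [h5, Fin.cons_succ]

/-- The part of the differential without the action term. -/
def dTail {n : ℕ} (F : (Fin n → G) → M) (g : Fin (n + 1) → G) : M :=
  ∑ j : Fin (n + 1), ((-1 : ℤ) ^ ((j : ℕ) + 1)) • F (Fin.contractNth j (· * ·) g)

/-- The homotopy sum. -/
def wSum (qf : G → Q) (τf : G → G) (t : G) {n : ℕ} (g : Fin n → G)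
    (F : (Fin (n + 1) → G) → M) : M :=
  ∑ j : Fin (n + 1), ((-1 : ℤ) ^ ((j : ℕ) + 1)) • F (insertSeq Q qf τf t g j)

theorem dTail_cons {n : ℕ} (F : (Fin (n + 1) → G) → M) (a : G) (g : Fin (n + 1) → G) :
    dTail F (Fin.cons a g) =
      - F (Fin.cons (a * g 0) (fun i => g i.succ)) - dTail (fun x => F (Fin.cons a x)) g := by
  rw [dTail, Fin.sum_univ_succ, contract_cons_zero, dTail, sub_eq_add_neg, ← Finset.sum_neg_distrib]
  congr 1
  · simp
  · refine Finset.sum_congr rfl fun j _ => ?_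
    rw [contract_cons_succ, Fin.val_succ, pow_succ _ ((j : ℕ) + 1)]
    simp

theorem dTail_zero (F : (Fin 0 → G) → M) (g : Fin 1 → G) :
    dTail F g = - F Fin.elim0 := by
  simp [dTail, Subsingleton.elim _ (Fin.elim0 : Fin 0 → G)]

theorem wSum_cons (qf : G → Q) (τf : G → G) (t a : G) {n : ℕ} (g : Fin n → G)
    (F : (Fin (n + 2) → G) → M) :
    wSum Q qf τf t (Fin.cons a g : Fin (n + 1) → G) F =
      - F (Fin.cons t (Fin.cons a g)) -
        wSum Q qf τf (τf (t * a)) g (fun x => F (Fin.cons (qf (t * a) : G) x)) := by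
  rw [wSum, Fin.sum_univ_succ, insertSeq_zero, wSum, sub_eq_add_neg, ← Finset.sum_neg_distrib]
  congr 1
  · simp
  · refine Finset.sum_congr rfl fun j _ => ?_
    rw [insertSeq_succ, Fin.val_succ, pow_succ _ ((j : ℕ) + 1)]
    simp

theorem wSum_zero (qf : G → Q) (τf : G → G) (t : G) (g : Fin 0 → G)
    (F : (Fin 1 → G) → M) :
    wSum Q qf τf t g F = - F (Fin.cons t g) := by
  simp [wSum, insertSeq_zero]

theorem wSum_add (qf : G → Q) (τf : G → G) (t : G) {n : ℕ} (g : Fin n → G)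
    (F F' : (Fin (n + 1) → G) → M) :
    wSum Q qf τf t g (fun x => F x + F' x) = wSum Q qf τf t g F + wSum Q qf τf t g F' := by
  simp [wSum, Finset.sum_add_distrib]

theorem wSum_neg (qf : G → Q) (τf : G → G) (t : G) {n : ℕ} (g : Fin n → G)
    (F : (Fin (n + 1) → G) → M) :
    wSum Q qf τf t g (fun x => - F x) = - wSum Q qf τf t g F := by
  simp [wSum]

theorem dTail_neg_sub {n : ℕ} (F F' : (Fin n → G) → M) (g : Fin (n + 1) → G) :
    dTail (fun x => - F x - F' x) g = - dTail F g - dTail F' g := by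
  simp [dTail, smul_sub, Finset.sum_sub_distrib]

theorem q_tau_mul (T : Set G) (qf : G → Q) (τf : G → G)
    (hτT : ∀ g : G, τf g ∈ T)
    (hfac : ∀ g : G, (qf g : G) * τf g = g)
    (huniq : ∀ (q : Q) (t : G), t ∈ T → qf ((q : G) * t) = q ∧ τf ((q : G) * t) = t)
    (x b : G) : qf (x * b) = qf x * qf (τf x * b) ∧ τf (x * b) = τf (τf x * b) := by
  have h : x * b = ((qf x * qf (τf x * b) : Q) : G) * τf (τf x * b) := by
    rw [Subgroup.coe_mul, mul_assoc, hfac, ← mul_assoc, hfac]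
  rw [h]
  exact huniq _ _ (hτT _)

theorem key (T : Set G) (qf : G → Q) (τf : G → G)
    (hτT : ∀ g : G, τf g ∈ T)
    (hfac : ∀ g : G, (qf g : G) * τf g = g)
    (huniq : ∀ (q : Q) (t : G), t ∈ T → qf ((q : G) * t) = q ∧ τf ((q : G) * t) = t)
    (n : ℕ) : ∀ (t : G) (g : Fin (n + 1) → G) (F : (Fin (n + 1) → G) → M),
    wSum Q qf τf t g (dTail F) + dTail (fun x => wSum Q qf τf t x F) g =
      F (fun i => (hSeq Q qf τf t g i : G)) := by
  have hcoe : ∀ {m : ℕ} (q : Q) (f : Fin m → Q),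
      (fun i => (((Fin.cons q f : Fin (m + 1) → Q) i : Q) : G)) =
        (Fin.cons (q : G) (fun i => (f i : G)) : Fin (m + 1) → G) := by
    intro m q f
    funext i
    refine Fin.cases ?_ (fun i => ?_) i <;> simp
  induction n with
  | zero =>
    intro t g F
    obtain ⟨a, g, rfl⟩ : ∃ a g', g = Fin.cons a g' :=
      ⟨g 0, Fin.tail g, (Fin.cons_self_tail g).symm⟩
    have hg : ∀ x y : Fin 0 → G, x = y := fun x y => Subsingleton.elim x y
    rw [wSum_cons, wSum_zero, dTail_zero, wSum_zero, hSeq_cons, hcoe, dTail_cons, dTail_cons,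
      dTail_zero, dTail_zero]
    simp only [Fin.cons_zero, Fin.cons_succ, hfac]
    rw [hg Fin.elim0 g, hg (fun i => (hSeq Q qf τf (τf (t * a)) g i : G)) g]
    abel
  | succ n ih =>
    intro t g F
    obtain ⟨a, g, rfl⟩ : ∃ a g', g = Fin.cons a g' :=
      ⟨g 0, Fin.tail g, (Fin.cons_self_tail g).symm⟩
    have IH := ih (τf (t * a)) g (fun x => F (Fin.cons (qf (t * a) : G) x))
    rw [wSum_cons, hSeq_cons, hcoe, ← IH, dTail_cons, dTail_cons]
    simp only [wSum_cons, dTail_cons, sub_eq_add_neg, wSum_add, wSum_neg]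
    simp only [← sub_eq_add_neg, dTail_neg_sub]
    obtain ⟨b, g, rfl⟩ : ∃ a g', g = Fin.cons a g' :=
      ⟨g 0, Fin.tail g, (Fin.cons_self_tail g).symm⟩
    obtain ⟨h1, h2⟩ := q_tau_mul Q T qf τf hτT hfac huniq (t * a) b
    rw [mul_assoc] at h1 h2
    rw [wSum_cons Q qf τf (τf (t * a)) b g
      (fun x => F (Fin.cons ((qf (t * a) : G) * x 0) fun i => x i.succ))]
    simp only [Fin.cons_zero, Fin.cons_succ, hfac, h1, h2, Subgroup.coe_mul]
    abel

end Helpers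

/-- `ψ(φ(θ)) − θ = ϖ(dⁿθ) + d^{n−1}(ϖ(θ))` (for `n = 0` the second summand
is absent); in particular `ψ ∘ φ` is chain homotopic to the identity. -/
theorem shapiro_homotopy
    (T : Set G) (hT1 : (1 : G) ∈ T)
    (qf : G → Q) (τf : G → G)
    (hτT : ∀ g : G, τf g ∈ T)
    (hfac : ∀ g : G, (qf g : G) * τf g = g)
    (huniq : ∀ (q : Q) (t : G), t ∈ T → qf ((q : G) * t) = q ∧ τf ((q : G) * t) = t)
    (psi : ∀ n : ℕ, ((Fin n → Q) → M) → ((Fin n → G) → (G → M)))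
    (hpsiCoind : ∀ (n : ℕ) (μ : (Fin n → Q) → M) (g : Fin n → G), IsCoind Q (psi n μ g))
    (hpsiT : ∀ (n : ℕ) (μ : (Fin n → Q) → M) (g : Fin n → G) (t : G), t ∈ T →
      psi n μ g t = μ (hSeq Q qf τf t g))
    (varpi : ∀ n : ℕ, ((Fin (n + 1) → G) → (G → M)) → ((Fin n → G) → (G → M)))
    (hvarpiCoind : ∀ (n : ℕ) (θ : (Fin (n + 1) → G) → (G → M)) (g : Fin n → G),
      IsCoind Q (varpi n θ g))
    (hvarpiT : ∀ (n : ℕ) (θ : (Fin (n + 1) → G) → (G → M)) (g : Fin n → G) (t : G), t ∈ T →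
      varpi n θ g t =
        ∑ j : Fin (n + 1), ((-1 : ℤ) ^ ((j : ℕ) + 1)) • θ (insertSeq Q qf τf t g j) 1) :
    (∀ θ : (Fin 0 → G) → (G → M), (∀ g, IsCoind Q (θ g)) →
      psi 0 (phiMap Q θ) - θ = varpi 0 (dI coindRho θ)) ∧
    (∀ (n : ℕ) (θ : (Fin (n + 1) → G) → (G → M)), (∀ g, IsCoind Q (θ g)) →
      psi (n + 1) (phiMap Q θ) - θ =
        varpi (n + 1) (dI coindRho θ) + dI coindRho (varpi n θ)) := by
  have ext_T : ∀ f f' : G → M, IsCoind Q f → IsCoind Q f' → (∀ t ∈ T, f t = f' t) → f = f' := by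
    intro f f' hf hf' h
    funext x
    rw [← hfac x, hf, hf', h _ (hτT x)]
  have sub_C : ∀ f f' : G → M, IsCoind Q f → IsCoind Q f' → IsCoind Q (f - f') := by
    intro f f' hf hf' q x
    simp only [Pi.sub_apply, hf q x, hf' q x, smul_sub]
  have add_C : ∀ f f' : G → M, IsCoind Q f → IsCoind Q f' → IsCoind Q (f + f') := by
    intro f f' hf hf' q x
    simp only [Pi.add_apply, hf q x, hf' q x, smul_add]
  have d_C : ∀ (n : ℕ) (θ : (Fin n → G) → (G → M)), (∀ g, IsCoind Q (θ g)) →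
      ∀ g, IsCoind Q (dI coindRho θ g) := by
    intro n θ hθ g q x
    simp only [dI, coindRho, AddMonoidHom.coe_mk, ZeroHom.coe_mk, Pi.add_apply,
      Finset.sum_apply, Pi.smul_apply, smul_add, Finset.smul_sum, mul_assoc, hθ _ q]
    congr 1
    refine Finset.sum_congr rfl fun j _ => ?_
    rw [smul_comm]
  have d_apply : ∀ (n : ℕ) (θ : (Fin n → G) → (G → M)) (g : Fin (n + 1) → G) (x : G),
      dI coindRho θ g x = θ (fun i => g i.succ) (x * g 0) + dTail (fun y => θ y x) g := by
    intro n θ g x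
    simp [dI, coindRho, dTail]
  have varpi_w : ∀ (n : ℕ) (θ : (Fin (n + 1) → G) → (G → M)) (g : Fin n → G) (t : G), t ∈ T →
      varpi n θ g t = wSum Q qf τf t g (fun x => θ x 1) := hvarpiT
  constructor
  · intro θ hθ
    funext g
    refine ext_T _ _ (sub_C _ _ (hpsiCoind _ _ _) (hθ g)) (hvarpiCoind _ _ _) fun t ht => ?_
    have hg : ∀ x y : Fin 0 → G, x = y := fun x y => Subsingleton.elim x y
    rw [varpi_w _ _ _ _ ht, wSum_zero, d_apply, dTail_zero, Pi.sub_apply, Pi.sub_apply,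
      hpsiT _ _ _ _ ht, phiMap]
    simp only [Fin.cons_zero, Fin.cons_succ, one_mul]
    rw [hg Fin.elim0 g, hg (fun i => (hSeq Q qf τf t g i : G)) g]
    abel
  · intro n θ hθ
    funext g
    refine ext_T _ _ (sub_C _ _ (hpsiCoind _ _ _) (hθ g))
      (add_C _ _ (hvarpiCoind _ _ _) (d_C _ _ (hvarpiCoind _ _) _)) fun t ht => ?_
    have K := key Q T qf τf hτT hfac huniq n t g (fun x => θ x 1)
    rw [Pi.sub_apply, Pi.sub_apply, Pi.add_apply, Pi.add_apply, hpsiT _ _ _ _ ht, phiMap, ← K,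
      varpi_w _ _ _ _ ht, d_apply]
    simp only [d_apply, wSum_add, varpi_w _ _ _ _ ht, one_mul]
    obtain ⟨a, g, rfl⟩ : ∃ a g', g = Fin.cons a g' :=
      ⟨g 0, Fin.tail g, (Fin.cons_self_tail g).symm⟩
    rw [wSum_cons Q qf τf t a g (fun x => θ (fun i => x i.succ) (x 0))]
    simp only [Fin.cons_zero, Fin.cons_succ]
    have h1 : varpi n θ g (t * a) = wSum Q qf τf (τf (t * a)) g (fun x => θ x (qf (t * a) : G)) := by
      conv_lhs => rw [← hfac (t * a)]
      rw [hvarpiCoind, varpi_w _ _ _ _ (hτT _)]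
      simp only [wSum, Finset.smul_sum]
      refine Finset.sum_congr rfl fun j _ => ?_
      rw [smul_comm, ← hθ, mul_one]
    rw [h1]
    abel
end

section
/- Let ω = (ω₁, ω₂, ω₃) be a weak homomorphism of crossed modules from K = (H →∂ G) to 2-Aut(A). Then for all x, y ∈ H and g ∈ G the following identity holds in the unit group Aˣ: ω₃(∂y, ∂x·g) · ω₁(∂y)(ω₃(∂x, g)) · ω₂(y) · ω₂(x) = ω₃(∂(y·x), g) · ω₂(y·x). -/
/-- For a weak homomorphism `ω = (ω₁, ω₂, ω₃)` of crossed modules from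
`K = (H →∂ G)` to `2-Aut(A)`, for all `x, y ∈ H` and `g ∈ G`:
`ω₃(∂y, ∂x·g) · ω₁(∂y)(ω₃(∂x, g)) · ω₂(y) · ω₂(x) = ω₃(∂(y·x), g) · ω₂(y·x)`. -/
theorem weak_homomorphism_vertical_multiplicativity
    {H G : Type*} [Group H] [Group G]
    (δ : H →* G) (act : G →* MulAut H)
    (hcm1 : ∀ (g : G) (h : H), δ (act g h) = g * δ h * g⁻¹)
    (hcm2 : ∀ h h' : H, act (δ h) h' = h * h' * h⁻¹)
    {A : Type*} [Ring A]
    (ω₁ : G →* RingAut A) (ω₂ : H → Aˣ) (ω₃ : G → G → Aˣ)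
    (hcentral : ∀ f g : G, (ω₃ f g : A) ∈ Set.center A)
    (hnorm : ∀ g : G, ω₃ g 1 = 1 ∧ ω₃ 1 g = 1)
    (hcoc : ∀ f g h : G, ω₁ f ((ω₃ g h : A)) * (ω₃ f (g * h) : A)
        = (ω₃ (f * g) h : A) * (ω₃ f g : A))
    (hω₂mul : ∀ x y : H, (ω₂ (x * y) : A) = (ω₃ (δ x) (δ y) : A) * (ω₂ x : A) * (ω₂ y : A))
    (hinner : ∀ (x : H) (a : A), ω₁ (δ x) a = (ω₂ x : A) * a * (((ω₂ x)⁻¹ : Aˣ) : A))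
    (hcompat : ∀ (f : G) (x : H), (ω₂ (act f x) : A)
        = ω₁ f ((ω₃ (δ x) f⁻¹ : A)) * (ω₃ f (δ x * f⁻¹) : A) * (((ω₃ f f⁻¹)⁻¹ : Aˣ) : A)
          * ω₁ f ((ω₂ x : A))) :
    ∀ (x y : H) (g : G),
      (ω₃ (δ y) (δ x * g) : A) * ω₁ (δ y) ((ω₃ (δ x) g : A)) * (ω₂ y : A) * (ω₂ x : A)
        = (ω₃ (δ (y * x)) g : A) * (ω₂ (y * x) : A) := by
  intro x y g
  have hc : (ω₃ (δ y) (δ x * g) : A) * ω₁ (δ y) ((ω₃ (δ x) g : A))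
      = ω₁ (δ y) ((ω₃ (δ x) g : A)) * (ω₃ (δ y) (δ x * g) : A) :=
    (Set.mem_center_iff.mp (hcentral (δ y) (δ x * g))).comm _
  rw [hc, hcoc, hω₂mul, map_mul]
  simp only [mul_assoc]
end

section
/- Let ω = (ω₁, ω₂, ω₃) be a weak homomorphism of crossed modules from K = (H →∂ G) to 2-Aut(A). Then for all x, y ∈ H and f, g ∈ G the following naturality identity holds in the unit group Aˣ: ω₃(∂x·f, ∂y·g) · ω₁(∂x·f)(ω₃(∂y, g) · ω₂(y)) · ω₃(∂x, f) · ω₂(x) = ω₃(∂(x · ᶠy), f·g) · ω₂(x · ᶠy) · ω₃(f, g). -/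
theorem comm_group_aux {C : Type*} [AddCommGroup C] (r P p1 q p2 Q p3 : C) :
    r + P + -p1 + (q + (-p2 + (p1 + Q))) = P + Q + p3 + q + -(p3 + p2) + r := by
  abel

/-- For a weak homomorphism `ω = (ω₁, ω₂, ω₃)` of crossed modules from
`K = (H →∂ G)` to `2-Aut(A)`, for all `x, y ∈ H` and `f, g ∈ G` the naturality identity
`ω₃(∂x·f, ∂y·g) · ω₁(∂x·f)(ω₃(∂y, g)·ω₂(y)) · ω₃(∂x, f) · ω₂(x)
  = ω₃(∂(x·ᶠy), f·g) · ω₂(x·ᶠy) · ω₃(f, g)` holds. -/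
theorem weak_homomorphism_naturality
    {H G : Type*} [Group H] [Group G]
    (δ : H →* G) (act : G →* MulAut H)
    (hcm1 : ∀ (g : G) (h : H), δ (act g h) = g * δ h * g⁻¹)
    (hcm2 : ∀ h h' : H, act (δ h) h' = h * h' * h⁻¹)
    {A : Type*} [Ring A]
    (ω₁ : G →* RingAut A) (ω₂ : H → Aˣ) (ω₃ : G → G → Aˣ)
    (hcentral : ∀ f g : G, (ω₃ f g : A) ∈ Set.center A)
    (hnorm : ∀ g : G, ω₃ g 1 = 1 ∧ ω₃ 1 g = 1)
    (hcoc : ∀ f g h : G, ω₁ f ((ω₃ g h : A)) * (ω₃ f (g * h) : A)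
        = (ω₃ (f * g) h : A) * (ω₃ f g : A))
    (hω₂mul : ∀ x y : H, (ω₂ (x * y) : A) = (ω₃ (δ x) (δ y) : A) * (ω₂ x : A) * (ω₂ y : A))
    (hinner : ∀ (x : H) (a : A), ω₁ (δ x) a = (ω₂ x : A) * a * (((ω₂ x)⁻¹ : Aˣ) : A))
    (hcompat : ∀ (f : G) (x : H), (ω₂ (act f x) : A)
        = ω₁ f ((ω₃ (δ x) f⁻¹ : A)) * (ω₃ f (δ x * f⁻¹) : A) * (((ω₃ f f⁻¹)⁻¹ : Aˣ) : A)
          * ω₁ f ((ω₂ x : A))) :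
    ∀ (x y : H) (f g : G),
      (ω₃ (δ x * f) (δ y * g) : A)
          * ω₁ (δ x * f) ((ω₃ (δ y) g : A) * (ω₂ y : A))
          * (ω₃ (δ x) f : A) * (ω₂ x : A)
        = (ω₃ (δ (x * act f y)) (f * g) : A) * (ω₂ (x * act f y) : A) * (ω₃ f g : A) := by
  intro x y f g
  have hc : ∀ (f g : G) (a : A), (ω₃ f g : A) * a = a * (ω₃ f g : A) := fun f g a =>
    (Set.mem_center_iff.1 (hcentral f g)).comm a
  have hci : ∀ (f g : G) (a : A),
      (((ω₃ f g)⁻¹ : Aˣ) : A) * a = a * (((ω₃ f g)⁻¹ : Aˣ) : A) := fun f g a =>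
    ((show Commute (ω₃ f g : A) a from hc f g a).units_inv_left)
  -- elements of the image of `δ` act trivially on the cocycle
  have htriv : ∀ (z : H) (f g : G), ω₁ (δ z) (ω₃ f g : A) = (ω₃ f g : A) := by
    intro z f g
    rw [hinner, ← hc, mul_assoc, Units.mul_inv, mul_one]
  have hcz : ∀ (z : H) (g h : G), (ω₃ g h : A) * (ω₃ (δ z) (g * h) : A)
      = (ω₃ (δ z * g) h : A) * (ω₃ (δ z) g : A) := by
    intro z g h
    rw [← hcoc, htriv]
  -- the cocycle as units of the center
  let W : G → G → (Subring.center A)ˣ := fun f g =>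
    ⟨⟨(ω₃ f g : A), hcentral f g⟩,
     ⟨(((ω₃ f g)⁻¹ : Aˣ) : A), Subring.mem_center_iff.2 fun a => (hci f g a).symm⟩,
     Subtype.ext (by simp), Subtype.ext (by simp)⟩
  have hW : ∀ f g, (((W f g : (Subring.center A)ˣ) : Subring.center A) : A) = (ω₃ f g : A) :=
    fun _ _ => rfl
  have hWi : ∀ f g, ((((W f g)⁻¹ : (Subring.center A)ˣ) : Subring.center A) : A)
      = (((ω₃ f g)⁻¹ : Aˣ) : A) :=
    fun _ _ => rfl
  have hWz : ∀ (z : H) (g h : G), W g h * W (δ z) (g * h) = W (δ z * g) h * W (δ z) g := by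
    intro z g h
    apply Units.ext; apply Subtype.ext
    exact hcz z g h
  have hcf : δ (act f y) * f = f * δ y := by rw [hcm1]; group
  have key : W (δ x * f * δ y) g * W (δ x * f) (δ y) * W (δ x) f
      = W (δ (x * act f y)) (f * g) * W (δ x) (δ (act f y)) * W (f * δ y) f⁻¹ * W f (δ y)
        * (W f f⁻¹)⁻¹ * W f g := by
    have e1 := hWz x f (δ y)
    have e2 := hWz (x * act f y) f g
    have e3 := hWz x (δ (act f y)) f
    have e4 := hWz (act f y) f f⁻¹
    have e5 : W (δ (act f y)) 1 = 1 := by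
      apply Units.ext; apply Subtype.ext
      simp [hW, (hnorm _).1]
    rw [mul_inv_cancel, e5, mul_one, hcf] at e4
    rw [hcf] at e3
    have e6 : δ (x * act f y) * f = δ x * f * δ y := by rw [map_mul, mul_assoc, hcf, mul_assoc]
    rw [e6] at e2
    rw [← map_mul] at e3
    have e2' : W (δ x * f * δ y) g
        = W f g * W (δ (x * act f y)) (f * g) * (W (δ (x * act f y)) f)⁻¹ := by
      rw [e2]; simp
    have e3' : W (δ x) (f * δ y) = (W (δ (act f y)) f)⁻¹ *
        (W (δ (x * act f y)) f * W (δ x) (δ (act f y))) := by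
      rw [← e3]; simp
    rw [mul_assoc, ← e1, e2', e3', e4]
    exact comm_group_aux (C := Additive (Subring.center A)ˣ) _ _ _ _ _ _ _
  have key' := congrArg (fun u : (Subring.center A)ˣ => ((u : Subring.center A) : A)) key
  simp only [Units.val_mul, Subring.coe_mul, hW, hWi] at key'
  have hL : (ω₃ (δ x * f) (δ y * g) : A) * ω₁ (δ x * f) (ω₃ (δ y) g : A)
      = (ω₃ (δ x * f * δ y) g : A) * (ω₃ (δ x * f) (δ y) : A) := by
    rw [hc, hcoc]
  have hY : ω₁ (δ x * f) (ω₂ y : A) * (ω₂ x : A) = (ω₂ x : A) * ω₁ f (ω₂ y : A) := by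
    rw [map_mul, RingAut.mul_apply, hinner, mul_assoc, Units.inv_mul, mul_one]
  have hR : ω₁ f (ω₃ (δ y) f⁻¹ : A) * (ω₃ f (δ y * f⁻¹) : A)
      = (ω₃ (f * δ y) f⁻¹ : A) * (ω₃ f (δ y) : A) := hcoc _ _ _
  rw [hω₂mul, hcompat, hR, map_mul (ω₁ (δ x * f)), ← mul_assoc, hL]
  calc _ = (ω₃ (δ x * f * δ y) g : A) * (ω₃ (δ x * f) (δ y) : A) * (ω₃ (δ x) f : A)
        * (ω₁ (δ x * f) (ω₂ y : A) * (ω₂ x : A)) := by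
        simp only [mul_assoc]
        rw [hc (δ x) f (ω₂ x : A), ← mul_assoc (ω₁ (δ x * f) (ω₂ y : A)), hc (δ x) f]
    _ = _ := by
        rw [hY, key']
        set F := ω₁ f (ω₂ y : A)
        have hx : ∀ a b : G, (ω₃ a b : A) * (ω₂ x : A) = (ω₂ x : A) * (ω₃ a b : A) :=
          fun a b => hc a b _
        simp only [mul_assoc]
        have hxl : ∀ (a b : G) (t : A), (ω₂ x : A) * ((ω₃ a b : A) * t)
            = (ω₃ a b : A) * ((ω₂ x : A) * t) := by
          intro a b t
          rw [← mul_assoc, ← hx, mul_assoc]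
        have hxi : ∀ (a b : G) (t : A), (ω₂ x : A) * ((((ω₃ a b)⁻¹ : Aˣ) : A) * t)
            = (((ω₃ a b)⁻¹ : Aˣ) : A) * ((ω₂ x : A) * t) := by
          intro a b t
          rw [← mul_assoc, ← hci, mul_assoc]
        rw [← hc f g F]
        simp only [hxl, hxi]
end

section
/- If μ and ν are realizable 2-cocycles G × G → Kˣ, then the pointwise product μ·ν and the pointwise inverse μ⁻¹ are realizable, and the constant cocycle 1 is realizable; consequently the realizable 2-cocycles form a subgroup of the group of all Kˣ-valued 2-cocycles on G under pointwise multiplication. -/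
universe u v w

/-- A 2-cocycle on `G` with values in `Kˣ` (trivial `G`-action):
`μ(h,k)·μ(g,h·k) = μ(g·h,k)·μ(g,h)`. -/
def IsCocycle {K : Type u} [Field K] {G : Type v} [Group G] (μ : G → G → Kˣ) : Prop :=
  ∀ g h k : G, μ h k * μ g (h * k) = μ (g * h) k * μ g h

/-- A realization of a 2-cocycle `μ`: a nonzero finite-dimensional `K`-vector space `V`
together with `ρ : G → GL(V)` such that `ρ(f·g) = μ(f,g)·(ρ(f) ∘ ρ(g))`. -/
structure Realization (K : Type u) [Field K] (G : Type v) [Group G] (μ : G → G → Kˣ) where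
  V : Type u
  [instAddCommGroup : AddCommGroup V]
  [instModule : Module K V]
  [instNontrivial : Nontrivial V]
  [instFinite : FiniteDimensional K V]
  ρ : G → (Module.End K V)ˣ
  hρ : ∀ f g : G, (ρ (f * g) : Module.End K V)
      = (μ f g : K) • ((ρ f : Module.End K V) * (ρ g : Module.End K V))

/-- A 2-cocycle `μ` is realizable if it admits a realization on a nonzero
finite-dimensional `K`-vector space. -/
def IsRealizable (K : Type u) [Field K] (G : Type v) [Group G] (μ : G → G → Kˣ) : Prop :=
  Nonempty (Realization K G μ)

theorem IsRealizable.mul_aux {K : Type u} [Field K] {G : Type v} [Group G] {μ ν : G → G → Kˣ}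
    (hμ : IsRealizable K G μ) (hν : IsRealizable K G ν) :
    IsRealizable K G (fun f g => μ f g * ν f g) := by
  obtain ⟨⟨V, ρ, hρ⟩⟩ := hμ
  obtain ⟨⟨W, σ, hσ⟩⟩ := hν
  have : Nontrivial (TensorProduct K V W) := by
    apply Module.nontrivial_of_finrank_pos (R := K)
    rw [Module.finrank_tensorProduct]
    exact Nat.mul_pos Module.finrank_pos Module.finrank_pos
  refine ⟨⟨TensorProduct K V W, fun g =>
    ⟨TensorProduct.map (ρ g : Module.End K V) (σ g : Module.End K W),
     TensorProduct.map (↑(ρ g)⁻¹ : Module.End K V) (↑(σ g)⁻¹ : Module.End K W), ?_, ?_⟩, ?_⟩⟩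
  · rw [← TensorProduct.map_mul, Units.mul_inv, Units.mul_inv, TensorProduct.map_one]
  · rw [← TensorProduct.map_mul, Units.inv_mul, Units.inv_mul, TensorProduct.map_one]
  · intro f g
    simp only [hρ, hσ, ← TensorProduct.map_mul, TensorProduct.map_smul_left,
      TensorProduct.map_smul_right, smul_smul, Units.val_mul]
    rw [mul_comm (ν f g : K)]

theorem IsRealizable.inv_aux {K : Type u} [Field K] {G : Type v} [Group G] {μ : G → G → Kˣ}
    (hμ : IsRealizable K G μ) :
    IsRealizable K G (fun f g => (μ f g)⁻¹) := by
  obtain ⟨⟨V, ρ, hρ⟩⟩ := hμ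
  have key : ∀ f g : G, (↑(ρ (f * g))⁻¹ : Module.End K V)
      = (↑(μ f g)⁻¹ : K) • ((↑(ρ g)⁻¹ : Module.End K V) * (↑(ρ f)⁻¹ : Module.End K V)) := by
    intro f g
    rw [Units.inv_eq_of_mul_eq_one_right]
    rw [hρ, smul_mul_smul_comm, Units.mul_inv, one_smul, mul_assoc,
      Units.mul_inv_cancel_left, Units.mul_inv]
  refine ⟨⟨Module.Dual K V, fun g =>
    ⟨Module.Dual.transpose (↑(ρ g)⁻¹ : Module.End K V),
     Module.Dual.transpose (ρ g : Module.End K V), ?_, ?_⟩, ?_⟩⟩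
  · ext φ x
    change φ (((ρ g : Module.End K V) * (↑(ρ g)⁻¹ : Module.End K V)) x) = φ x
    rw [Units.mul_inv]; rfl
  · ext φ x
    change φ (((↑(ρ g)⁻¹ : Module.End K V) * (ρ g : Module.End K V)) x) = φ x
    rw [Units.inv_mul]; rfl
  · intro f g
    ext φ x
    change φ ((↑(ρ (f * g))⁻¹ : Module.End K V) x) = (↑(μ f g)⁻¹ : K) •
      φ (((↑(ρ g)⁻¹ : Module.End K V) * (↑(ρ f)⁻¹ : Module.End K V)) x)
    rw [key, LinearMap.smul_apply, map_smul]

theorem IsRealizable.one_aux (K : Type u) [Field K] (G : Type v) [Group G] :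
    IsRealizable K G (fun _ _ => (1 : Kˣ)) :=
  ⟨⟨K, fun _ => 1, fun _ _ => by simp⟩⟩

/-- If `μ` and `ν` are realizable 2-cocycles then `μ·ν`, `μ⁻¹` and the
constant cocycle `1` are realizable; consequently the realizable 2-cocycles form a subgroup
of the group of all `Kˣ`-valued 2-cocycles on `G` under pointwise multiplication. -/
theorem realizable_cocycles_subgroup
    {K : Type u} [Field K] {G : Type v} [Group G]
    (μ ν : G → G → Kˣ) (hμc : IsCocycle μ) (hνc : IsCocycle ν)
    (hμ : IsRealizable K G μ) (hν : IsRealizable K G ν) :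
    IsRealizable K G (fun f g => μ f g * ν f g) ∧
    IsRealizable K G (fun f g => (μ f g)⁻¹) ∧
    IsRealizable K G (fun _ _ => (1 : Kˣ)) ∧
    ∃ S : Subgroup (G → G → Kˣ), ∀ θ : G → G → Kˣ,
      θ ∈ S ↔ (IsCocycle θ ∧ IsRealizable K G θ) := by
  refine ⟨hμ.mul_aux hν, hμ.inv_aux, IsRealizable.one_aux K G,
    { carrier := {θ | IsCocycle θ ∧ IsRealizable K G θ}
      mul_mem' := ?_
      one_mem' := ?_
      inv_mem' := ?_ }, fun θ => Iff.rfl⟩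
  · rintro a b ⟨ha, ha'⟩ ⟨hb, hb'⟩
    refine ⟨fun g h k => ?_, ha'.mul_aux hb'⟩
    simp only [Pi.mul_apply]
    rw [mul_mul_mul_comm, ha, hb, mul_mul_mul_comm]
  · exact ⟨fun g h k => rfl, IsRealizable.one_aux K G⟩
  · rintro a ⟨ha, ha'⟩
    refine ⟨fun g h k => ?_, ha'.inv_aux⟩
    simp only [Pi.inv_apply]
    rw [← mul_inv, ha, mul_inv]
end

section
/- Let H ≤ G be a subgroup of finite index and let μ : G × G → Kˣ be a 2-cocycle. If the restriction of μ to H × H is realizable (as a 2-cocycle on the group H), then μ is realizable. -/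
universe u v w

/-- Transport of a realization from any universe. -/
theorem isRealizable_of_end {K : Type u} [Field K] {G : Type v} [Group G] (μ : G → G → Kˣ)
    (W : Type w) [AddCommGroup W] [Module K W] [Nontrivial W] [FiniteDimensional K W]
    (R : G → Module.End K W) (hinj : ∀ g, Function.Injective (R g))
    (hR : ∀ f g, R (f * g) = (μ f g : K) • (R f * R g)) : IsRealizable K G μ := by
  classical
  let e : W ≃ₗ[K] (Fin (Module.finrank K W) → K) := (Module.finBasis K W).equivFun
  have hu : ∀ g, IsUnit (e.conj (R g)) := by
    intro g
    rw [LinearMap.isUnit_iff_ker_eq_bot, LinearMap.ker_eq_bot]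
    intro a b hab
    simp only [LinearEquiv.conj_apply_apply] at hab
    exact e.symm.injective (hinj g (e.injective hab))
  haveI : Nontrivial (Fin (Module.finrank K W) → K) := e.symm.toEquiv.nontrivial
  refine ⟨{ V := Fin (Module.finrank K W) → K, ρ := fun g => (hu g).unit, hρ := ?_ }⟩
  intro f g
  simp only [IsUnit.unit_spec]
  rw [hR, map_smul]
  congr 1
  refine LinearMap.ext fun x => ?_
  simp [LinearEquiv.conj_apply_apply]

/-- The induced space. -/
def indSpace {K : Type u} [Field K] {G : Type v} [Group G] (H : Subgroup G)
    (μ : G → G → Kˣ) (r : Realization K H (fun h k : H => μ (h : G) (k : G))) :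
    letI := r.instAddCommGroup
    letI := r.instModule
    Submodule K (G → r.V) :=
  letI := r.instAddCommGroup
  letI := r.instModule
  { carrier := {F | ∀ (h : H) (x : G),
      F (h * x) = (μ h x : K) • (r.ρ h : Module.End K r.V) (F x)}
    add_mem' := by
      intro a b ha hb h x
      simp [ha h x, hb h x]
    zero_mem' := by
      intro h x
      simp
    smul_mem' := by
      intro c a ha h x
      simp only [Pi.smul_apply, ha h x, map_smul]
      rw [smul_comm] }

/-- If `H ≤ G` has finite index and the restriction of the 2-cocycle `μ`
to `H × H` is realizable as a 2-cocycle on `H`, then `μ` is realizable. -/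
theorem realizable_of_finiteIndex_restriction_realizable
    {K : Type u} [Field K] {G : Type v} [Group G]
    (H : Subgroup G) [H.FiniteIndex]
    (μ : G → G → Kˣ) (hμ : IsCocycle μ)
    (hres : IsRealizable K H (fun h k : H => μ (h : G) (k : G))) :
    IsRealizable K G μ := by
  classical
  obtain ⟨r⟩ := hres
  letI := r.instAddCommGroup
  letI := r.instModule
  haveI := r.instNontrivial
  haveI := r.instFinite
  have hc : ∀ g h k : G, (μ h k : K) * μ g (h * k) = μ (g * h) k * μ g h := fun g h k => by
    exact_mod_cast congrArg Units.val (hμ g h k)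
  have hmem : ∀ F : G → r.V, F ∈ indSpace H μ r ↔ ∀ (h : H) (x : G),
      F (h * x) = (μ h x : K) • (r.ρ h : Module.End K r.V) (F x) := fun F => Iff.rfl
  have hρinj : ∀ (h : H) (v : r.V), (r.ρ h : Module.End K r.V) v = 0 → v = 0 := by
    intro h v hv
    have h1 : ((r.ρ h)⁻¹ : (Module.End K r.V)ˣ).val ((r.ρ h : Module.End K r.V) v) = v := by
      rw [← Module.End.mul_apply, Units.inv_mul, Module.End.one_apply]
    rw [← h1, hv, map_zero]
  -- finite dimension
  haveI : FiniteDimensional K (indSpace H μ r) := by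
    let E : indSpace H μ r →ₗ[K] (G ⧸ H → r.V) :=
      { toFun := fun F q => F.1 (q.out)⁻¹
        map_add' := fun _ _ => rfl
        map_smul' := fun _ _ => rfl }
    haveI : Finite (G ⧸ H) := inferInstance
    refine FiniteDimensional.of_injective E ?_
    rw [injective_iff_map_eq_zero]
    intro F hF
    ext x
    obtain ⟨h, hh⟩ := QuotientGroup.mk_out_eq_mul H x⁻¹
    have h0 : F.1 ((QuotientGroup.mk x⁻¹ : G ⧸ H).out)⁻¹ = 0 := congrFun hF _
    have hx : x = (h : G) * ((QuotientGroup.mk x⁻¹ : G ⧸ H).out)⁻¹ := by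
      rw [hh]; group
    rw [hx, (hmem F.1).1 F.2, h0]
    simp
  -- nontriviality
  haveI : Nontrivial (indSpace H μ r) := by
    obtain ⟨v, hv⟩ := exists_ne (0 : r.V)
    let F : G → r.V := fun x => if hx : x ∈ H then
      (μ x 1 : K) • (r.ρ ⟨x, hx⟩ : Module.End K r.V) v else 0
    have hF : F ∈ indSpace H μ r := by
      rw [hmem]
      intro h x
      by_cases hx : x ∈ H
      · have hhx : (h : G) * x ∈ H := H.mul_mem h.2 hx
        simp only [F, dif_pos hx, dif_pos hhx]
        have h2 := r.hρ h ⟨x, hx⟩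
        have h3 : (⟨(h : G) * x, hhx⟩ : H) = h * ⟨x, hx⟩ := rfl
        rw [h3, h2]
        simp only [LinearMap.smul_apply, Module.End.mul_apply, map_smul, smul_smul]
        congr 1
        have h4 := hc h x 1
        rw [mul_one] at h4
        rw [← h4, mul_comm]
      · have hhx : (h : G) * x ∉ H := fun h' => hx ((H.mul_mem_cancel_left h.2).1 h')
        simp only [F, dif_neg hx, dif_neg hhx, map_zero, smul_zero]
    refine ⟨⟨⟨F, hF⟩, 0, ?_⟩⟩
    intro h0
    have h1 : F 1 = 0 := congrFun (congrArg Subtype.val h0) 1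
    simp only [F, dif_pos H.one_mem] at h1
    rcases smul_eq_zero.1 h1 with h2 | h2
    · exact (μ 1 1).ne_zero h2
    · exact hv (hρinj _ _ h2)
  let R : G → Module.End K (indSpace H μ r) := fun g =>
    { toFun := fun F => ⟨fun x => (μ x g : K)⁻¹ • F.1 (x * g), by
        rw [hmem]
        intro h x
        rw [mul_assoc, (hmem F.1).1 F.2, map_smul, smul_smul, smul_smul]
        congr 1
        have h4 := hc h x g
        have := (μ x g).ne_zero
        have := (μ (h * x) g).ne_zero
        field_simp
        linear_combination h4⟩
      map_add' := fun a b => by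
        ext x
        simp
      map_smul' := fun c a => by
        ext x
        exact smul_comm _ _ _ }
  have hRa : ∀ g F x, (R g F).1 x = (μ x g : K)⁻¹ • F.1 (x * g) := fun _ _ _ => rfl
  refine isRealizable_of_end μ (indSpace H μ r) R ?_ ?_
  · intro g
    rw [injective_iff_map_eq_zero]
    intro F hF
    ext x
    have h1 : (R g F).1 (x * g⁻¹) = 0 := by rw [hF]; rfl
    rw [hRa, inv_mul_cancel_right] at h1
    rcases smul_eq_zero.1 h1 with h2 | h2
    · exact absurd h2 (inv_ne_zero (Units.ne_zero _))
    · exact h2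
  · intro f g
    ext F x
    change (R (f * g) F).1 x = (μ f g : K) • (R f (R g F)).1 x
    rw [hRa, hRa, hRa, smul_smul, smul_smul, mul_assoc x f g]
    congr 1
    have h4 := hc x f g
    have := (μ x f).ne_zero
    have := (μ x (f * g)).ne_zero
    have := (μ (x * f) g).ne_zero
    field_simp
    linear_combination -h4
end

section
/- Let X be a finite G-set and μ : G × G → (Kˣ)^X a 2-cocycle for the G-module (Kˣ)^X (i.e. (f·μ(g,h)) · μ(f, g·h) = μ(f·g, h) · μ(f,g) pointwise, where (g·z)(x) = z(g⁻¹·x)). Say μ is realizable if there exist a finite-dimensional K-vector space M with a direct sum decomposition M = ⊕_{x∈X} M_x into nonzero subspaces and a function ρ : G → GL(M) with ρ(g)(M_x) = M_{g·x} for all g ∈ G, x ∈ X, such that ρ(f·g) = μ(f,g)·(ρ(f) ∘ ρ(g)) for all f,g ∈ G, where an element z ∈ (Kˣ)^X acts on M by z·m = z(x)·m for m ∈ M_x. For x ∈ X let G_x be the stabilizer of x and μ_x : G × G → Kˣ the component μ_x(g,h) = μ(g,h)(x). Then μ is realizable if and only if for every x ∈ X the restriction of μ_x to G_x × G_x is realizable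 as a scalar 2-cocycle on G_x (i.e. realizable on a nonzero finite-dimensional K-vector space). -/
universe u v w

/-- A realization of a 2-cocycle `μ : G × G → (Kˣ)^X` for the `G`-module `(Kˣ)^X`:
a finite-dimensional `K`-vector space `M` with a direct sum decomposition `M = ⊕_{x∈X} M_x`
into nonzero subspaces, and `ρ : G → GL(M)` with `ρ(g)(M_x) = M_{g·x}`, such that
`ρ(f·g) = μ(f,g)·(ρ(f) ∘ ρ(g))`, where `z ∈ (Kˣ)^X` acts on `M` by `z·m = z(x)·m` for
`m ∈ M_x` (so on `m ∈ M_x`, `ρ(f·g) m = μ(f,g)((f·g)·x) • ρ(f)(ρ(g) m)`). -/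
structure GSetRealization (K : Type u) [Field K] (G : Type v) [Group G]
    (X : Type w) [MulAction G X] (μ : G → G → X → Kˣ) where
  M : Type u
  [instAddCommGroup : AddCommGroup M]
  [instModule : Module K M]
  [instFinite : FiniteDimensional K M]
  piece : X → Submodule K M
  indep : ∀ x : X, Disjoint (piece x) (⨆ (y : X) (_ : y ≠ x), piece y)
  spans : (⨆ x : X, piece x) = ⊤
  nonzero : ∀ x : X, piece x ≠ ⊥
  ρ : G → (Module.End K M)ˣ
  perm : ∀ (g : G) (x : X), (piece x).map (ρ g : Module.End K M) = piece (g • x)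
  hρ : ∀ (f g : G) (x : X), ∀ m ∈ piece x,
    (ρ (f * g) : Module.End K M) m
      = (μ f g ((f * g) • x) : K) • (ρ f : Module.End K M) ((ρ g : Module.End K M) m)

section helpers

/-- From a compatible family of isomorphisms between the pieces, build a realization. -/
theorem gsetRealization_of_family
    {K : Type u} [Field K] {G : Type v} [Group G]
    {X : Type w} [Finite X] [MulAction G X]
    (μ : G → G → X → Kˣ)
    (V : X → Type u) [∀ x, AddCommGroup (V x)] [∀ x, Module K (V x)]
    [∀ x, Nontrivial (V x)] [∀ x, FiniteDimensional K (V x)]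
    (T : ∀ (g : G) (x y : X), g • x = y → (V x →ₗ[K] V y))
    (Tinj : ∀ (g : G) (x y : X) (h : g • x = y), Function.Injective (T g x y h))
    (Tmul : ∀ (f g : G) (x y z : X) (hg : g • x = y) (hf : f • y = z) (hfg : (f * g) • x = z)
      (v : V x), T (f * g) x z hfg v = (μ f g z : K) • T f y z hf (T g x y hg v)) :
    Nonempty (GSetRealization K G X μ) := by
  classical
  obtain ⟨n, ⟨e'⟩⟩ := Finite.exists_equiv_fin X
  obtain ⟨e, -⟩ : ∃ e : Fin n ≃ X, e = e'.symm := ⟨_, rfl⟩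
  let j : G → Fin n → Fin n := fun g i => e.symm (g⁻¹ • e i)
  have hj : ∀ g i, g • e (j g i) = e i := by intro g i; simp [j]
  have hj' : ∀ g i, j g (e.symm (g • e i)) = i := by intro g i; simp [j]
  have hjm : ∀ f g i, j (f * g) i = j g (j f i) := by
    intro f g i; simp [j, mul_smul]
  let M := (i : Fin n) → V (e i)
  let R : G → Module.End K M := fun g =>
    LinearMap.pi fun i => (T g (e (j g i)) (e i) (hj g i)) ∘ₗ LinearMap.proj (j g i)
  have hR : ∀ g (φ : M) i, R g φ i = T g (e (j g i)) (e i) (hj g i) (φ (j g i)) :=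
    fun g φ i => rfl
  have hz : ∀ g (φ : M) i, R g φ i = 0 ↔ φ (j g i) = 0 := by
    intro g φ i
    rw [hR]
    exact map_eq_zero_iff _ (Tinj _ _ _ _)
  have Rinj : ∀ g, Function.Injective (R g) := by
    intro g
    rw [injective_iff_map_eq_zero]
    intro φ h
    funext i
    have := (hz g φ (e.symm (g • e i))).1 (by rw [h]; rfl)
    rw [hj'] at this
    exact this
  have Rbij : ∀ g, Function.Bijective (R g) := fun g =>
    ⟨Rinj g, LinearMap.injective_iff_surjective.1 (Rinj g)⟩
  let ρ : G → (Module.End K M)ˣ := fun g =>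
    LinearMap.GeneralLinearGroup.ofLinearEquiv (LinearEquiv.ofBijective (R g) (Rbij g))
  have hρ : ∀ g, (ρ g : Module.End K M) = R g := fun g => rfl
  let P : X → Submodule K M := fun x =>
    { carrier := {φ | ∀ i, e i ≠ x → φ i = 0}
      zero_mem' := fun i _ => rfl
      add_mem' := by
        intro a b ha hb i hi
        rw [Pi.add_apply, ha i hi, hb i hi, add_zero]
      smul_mem' := by
        intro c a ha i hi
        rw [Pi.smul_apply, ha i hi, smul_zero] }
  have hP : ∀ x (φ : M), φ ∈ P x ↔ ∀ i, e i ≠ x → φ i = 0 := fun x φ => Iff.rfl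
  have hsingle : ∀ i (v : V (e i)), (Pi.single i v : M) ∈ P (e i) := by
    intro i v k hk
    exact Pi.single_eq_of_ne (M := fun i => V (e i)) (fun h : k = i => hk (congrArg e h)) v
  refine ⟨{ M := M, piece := P, indep := ?_, spans := ?_, nonzero := ?_, ρ := ρ,
            perm := ?_, hρ := ?_ }⟩
  · intro x
    rw [Submodule.disjoint_def]
    intro φ h1 h2
    have hle : (⨆ (y : X) (_ : y ≠ x), P y) ≤
        LinearMap.ker (LinearMap.proj (R := K) (φ := fun i => V (e i)) (e.symm x)) := by
      refine iSup₂_le fun y hy ψ hψ => ?_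
      rw [LinearMap.mem_ker]
      exact hψ _ (by simpa using hy.symm)
    have h3 : φ (e.symm x) = 0 := hle h2
    funext i
    by_cases hi : e i = x
    · have : i = e.symm x := by rw [← hi]; simp
      rw [this]; exact h3
    · exact h1 i hi
  · rw [eq_top_iff]
    intro φ _
    rw [← Finset.univ_sum_single φ]
    exact Submodule.sum_mem _ fun i _ => Submodule.mem_iSup_of_mem (e i) (hsingle i _)
  · intro x hx
    obtain ⟨i, rfl⟩ := e.surjective x
    obtain ⟨v, hv⟩ := exists_ne (0 : V (e i))
    have := hsingle i v
    rw [hx, Submodule.mem_bot] at this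
    apply hv
    have h2 := congrFun this i
    simpa using h2
  · intro g x
    rw [hρ]
    ext ψ
    rw [Submodule.mem_map]
    constructor
    · rintro ⟨φ, hφ, rfl⟩ i hi
      rw [hz]
      refine hφ _ fun h => hi ?_
      rw [← hj g i, h]
    · intro hψ
      obtain ⟨φ, rfl⟩ := (Rbij g).2 ψ
      refine ⟨φ, fun i hi => ?_, rfl⟩
      have := (hz g φ (e.symm (g • e i))).1 (hψ _ (by simpa using hi))
      rw [hj'] at this
      exact this
  · intro f g x m hm
    rw [hρ, hρ, hρ]
    funext i
    have key : ∀ (k k' : Fin n) (_ : k = k') (h1 : (f * g) • e k = e i)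
        (h2 : g • e k' = e (j f i)),
        T (f * g) (e k) (e i) h1 (m k) =
          (μ f g (e i) : K) • T f (e (j f i)) (e i) (hj f i) (T g (e k') (e (j f i)) h2 (m k')) := by
      rintro k k' rfl h1 h2
      exact Tmul _ _ _ _ _ _ _ _ _
    have h := key _ _ (hjm f g i) (hj _ _) (hj _ _)
    by_cases hi : e i = (f * g) • x
    · rw [← hi]; exact h
    · have h0 : m (j (f * g) i) = 0 := hm _ fun h => hi (by rw [← h, hj])
      have h0' : m (j g (j f i)) = 0 := by rw [← hjm]; exact h0
      have e1 : R (f * g) m i = 0 := (hz _ _ _).2 h0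
      have e2 : R f (R g m) i = 0 := (hz _ _ _).2 ((hz _ _ _).2 h0')
      rw [e1, Pi.smul_apply, e2, smul_zero]

attribute [instance] Realization.instAddCommGroup Realization.instModule
  Realization.instNontrivial Realization.instFinite

/-- Action of an element of the stabilizer, with transport along an equality of base points. -/
theorem exists_stabMap
    {K : Type u} [Field K] {G : Type v} [Group G] {X : Type w} [MulAction G X]
    {μ : G → G → X → Kˣ}
    (R : ∀ x : X, Realization K (MulAction.stabilizer G x) (fun g h => μ (g : G) (h : G) x)) :
    ∃ S : ∀ (k : G) (a b : X), a = b → k • a = b → ((R a).V →ₗ[K] (R b).V),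
      (∀ k a b h h', Function.Injective (S k a b h h')) ∧
      ∀ (k l : G) (a b c : X) (h1 : a = b) (h1' : l • a = b) (h2 : b = c) (h2' : k • b = c)
        (h3 : a = c) (h3' : (k * l) • a = c) (v : (R a).V),
        S (k * l) a c h3 h3' v = (μ k l c : K) • S k b c h2 h2' (S l a b h1 h1' v) := by
  refine ⟨fun k a b h => h ▸ fun h' => ((R a).ρ ⟨k, h'⟩ : Module.End K (R a).V), ?_, ?_⟩
  · rintro k a b rfl h'
    exact ((Module.End.isUnit_iff _).1 ((R a).ρ ⟨k, h'⟩).isUnit).1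
  · rintro k l a b c rfl h1' rfl h2' h3 h3' v
    exact congrArg (fun F : Module.End K (R a).V => F v) ((R a).hρ ⟨k, h2'⟩ ⟨l, h1'⟩)

theorem coeff_identity {A : Type*} [CommGroup A] {a b c d e f g h i k : A}
    (h1 : a * b = c * d) (h2 : e * f = g * h) (h3 : i * f = c * k) :
    g⁻¹ * b * a = h * (k⁻¹ * d) * (e⁻¹ * i) := by
  have ha : a = c * d * b⁻¹ := eq_mul_inv_of_mul_eq h1
  have he : e = g * h * f⁻¹ := eq_mul_inv_of_mul_eq h2
  have hi : i = c * k * f⁻¹ := eq_mul_inv_of_mul_eq h3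
  subst ha he hi
  apply Additive.ofMul.injective
  simp only [ofMul_mul, ofMul_inv]
  abel

end helpers

/-- A 2-cocycle `μ` for the `G`-module `(Kˣ)^X` (with `X` a finite
`G`-set) is realizable if and only if for every `x ∈ X` the restriction of the component
`μ_x` to the stabilizer `G_x` is realizable as a scalar 2-cocycle on `G_x`. -/
theorem gset_cocycle_realizable_iff
    {K : Type u} [Field K] {G : Type v} [Group G]
    {X : Type w} [Finite X] [MulAction G X]
    (μ : G → G → X → Kˣ)
    (hcoc : ∀ (f g h : G) (x : X),
      μ g h (f⁻¹ • x) * μ f (g * h) x = μ (f * g) h x * μ f g x) :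
    Nonempty (GSetRealization K G X μ) ↔
      ∀ x : X, IsRealizable K (MulAction.stabilizer G x)
        (fun g h => μ (g : G) (h : G) x) := by
  constructor
  · rintro ⟨R⟩ x
    obtain ⟨M, piece, indep, spans, nonzero, ρ, perm, hρ⟩ := R
    have hmem : ∀ (g : MulAction.stabilizer G x), ∀ m ∈ piece x,
        (ρ (g : G) : Module.End K M) m ∈ piece x := by
      intro g m hm
      have := Submodule.mem_map_of_mem (f := (ρ (g : G) : Module.End K M)) hm
      rw [perm, g.2] at this
      exact this
    have hinj : ∀ g : G, Function.Injective (ρ g : Module.End K M) := fun g =>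
      ((Module.End.isUnit_iff _).1 (ρ g).isUnit).1
    have hinj' : ∀ g : MulAction.stabilizer G x,
        Function.Injective ((ρ (g : G) : Module.End K M).restrict (hmem g)) := by
      intro g a b hab
      exact Subtype.ext (hinj g (congrArg Subtype.val hab))
    have : Nontrivial (piece x) := Submodule.nontrivial_iff_ne_bot.2 (nonzero x)
    let σ : MulAction.stabilizer G x → (Module.End K (piece x))ˣ := fun g =>
      LinearMap.GeneralLinearGroup.ofLinearEquiv
        (LinearEquiv.ofBijective ((ρ (g : G) : Module.End K M).restrict (hmem g))
          ⟨hinj' g, LinearMap.injective_iff_surjective.1 (hinj' g)⟩)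
    refine ⟨{ V := piece x, ρ := σ, hρ := ?_ }⟩
    intro f g
    ext m
    have := hρ f g x m m.2
    have hfg : ((f : G) * (g : G)) • x = x := (f * g).2
    rw [hfg] at this
    exact this
  · intro H
    have R := fun x => Classical.choice (H x)
    obtain ⟨S, Sinj, Smul⟩ := exists_stabMap R
    let rep : X → X := fun x => (Quotient.mk (MulAction.orbitRel G X) x).out
    have hrep : ∀ (g : G) (x y : X), g • x = y → rep x = rep y := by
      rintro g x y rfl
      have : Quotient.mk (MulAction.orbitRel G X) x = Quotient.mk (MulAction.orbitRel G X) (g • x) :=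
        Quotient.sound ((MulAction.orbitRel G X).symm ⟨g, rfl⟩)
      simp only [rep, this]
    have ht : ∀ x, ∃ t : G, t • rep x = x := by
      intro x
      have : (MulAction.orbitRel G X) x (rep x) :=
        (MulAction.orbitRel G X).symm (Quotient.mk_out x)
      exact this
    choose t ht using ht
    have ht' : ∀ x, (t x)⁻¹ • x = rep x := fun x => by
      rw [inv_smul_eq_iff, ht]
    have hS : ∀ (g : G) (x y : X), g • x = y → ((t y)⁻¹ * g * t x) • rep x = rep y := by
      intro g x y h
      rw [mul_smul, mul_smul, ht, h, ht']
    refine gsetRealization_of_family μ (fun x => (R (rep x)).V)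
      (fun g x y h => (((μ g (t x) y)⁻¹ * μ (t y) ((t y)⁻¹ * g * t x) y : Kˣ) : K) •
        S ((t y)⁻¹ * g * t x) (rep x) (rep y) (hrep g x y h) (hS g x y h)) ?_ ?_
    · intro g x y h a b hab
      simp only [LinearMap.smul_apply] at hab
      exact Sinj _ _ _ _ _ (smul_right_injective _ (Units.ne_zero _) hab)
    · intro f g x y z hg hf hfg v
      have hm : (t z)⁻¹ * (f * g) * t x = ((t z)⁻¹ * f * t y) * ((t y)⁻¹ * g * t x) := by group
      have hfz : f⁻¹ • z = y := by rw [inv_smul_eq_iff, hf]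
      have c1 := hcoc (t z) ((t z)⁻¹ * f * t y) ((t y)⁻¹ * g * t x) z
      have c2 := hcoc f g (t x) z
      have c3 := hcoc f (t y) ((t y)⁻¹ * g * t x) z
      have e1 : t z * ((t z)⁻¹ * f * t y) = f * t y := by group
      have e2 : t y * ((t y)⁻¹ * g * t x) = g * t x := by group
      rw [ht', e1] at c1
      rw [hfz] at c2 c3
      rw [e2] at c3
      have key := coeff_identity c1 c2 c3
      rw [mul_assoc (μ f g z), mul_comm (_ * _) ((μ g (t x) y)⁻¹ * _)] at key
      have hh := Smul ((t z)⁻¹ * f * t y) ((t y)⁻¹ * g * t x) (rep x) (rep y) (rep z)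
        (hrep _ _ _ hg) (hS _ _ _ hg) (hrep _ _ _ hf) (hS _ _ _ hf) (hrep _ _ _ hfg)
        (by rw [← hm]; exact hS _ _ _ hfg) v
      simp only [LinearMap.smul_apply, hm, map_smul]
      rw [hh]
      simp only [smul_smul]
      congr 1
      exact_mod_cast congrArg Units.val key
end
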